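/- There is a single computable function F : ℕ × List (ℕ × Bool) → Bool (one algorithm, uniform in the braid index) such that for every n ≥ 2 and every list w all of whose first components are < n-1, F(n, w) = true if and only if the word in the Artin generators of B_n obtained by reading each pair (i, ε) of w as σ_{i+1}^{±1} (sign according to ε) evaluates to the identity element of B_n. -/

import Mathlib

/-- The Artin relators for the braid group `B n`: commutation relations
`σ i σ j = σ j σ i` for `|i - j| ≥ 2`, and braid relations
`σ i σ j σ i = σ j σ i σ j` for `|i - j| = 1`, written as relators in the
free group on `Fin (n - 1)`. -/
def artinRels (n : ℕ) : Set (FreeGroup (Fin (n - 1))) :=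
  {r | ∃ i j : Fin (n - 1), ((i : ℕ) + 2 ≤ (j : ℕ) ∨ (j : ℕ) + 2 ≤ (i : ℕ)) ∧
      r = FreeGroup.of i * FreeGroup.of j * (FreeGroup.of i)⁻¹ * (FreeGroup.of j)⁻¹} ∪
  {r | ∃ i j : Fin (n - 1), ((i : ℕ) + 1 = (j : ℕ) ∨ (j : ℕ) + 1 = (i : ℕ)) ∧
      r = FreeGroup.of i * FreeGroup.of j * FreeGroup.of i *
        (FreeGroup.of j * FreeGroup.of i * FreeGroup.of j)⁻¹}

/-- The braid group `B n` on `n` strands, presented with the `n - 1` Artin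
generators `σ_1, …, σ_{n-1}` (indexed by `Fin (n - 1)`) and the Artin relations. -/
def BraidGroup (n : ℕ) : Type := PresentedGroup (artinRels n)

instance (n : ℕ) : Group (BraidGroup n) := by unfold BraidGroup; infer_instance

/-- The Artin generator `σ_{i+1}` of `B n`, for `i : Fin (n - 1)`. -/
def braidGen (n : ℕ) (i : Fin (n - 1)) : BraidGroup n := PresentedGroup.of i

/-- Evaluation of a word in the Artin generators in the braid group `B n`:
a pair `(i, ε)` is read as `σ i` if `ε = true` and as `(σ i)⁻¹` if `ε = false`. -/
def evalWord (n : ℕ) (w : List (Fin (n - 1) × Bool)) : BraidGroup n :=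
  (w.map fun p => if p.2 then braidGen n p.1 else (braidGen n p.1)⁻¹).prod

/-- Evaluation of a word with `ℕ`-indexed letters in the braid group `B n`:
a pair `(i, ε)` with `i < n - 1` is read as `σ_{i+1}^{±1}` (sign according to `ε`);
out-of-range letters (which do not occur under our hypotheses) are read as `1`. -/
def evalWordNat (n : ℕ) (w : List (ℕ × Bool)) : BraidGroup n :=
  (w.map fun p =>
    if h : p.1 < n - 1 then
      (if p.2 then braidGen n ⟨p.1, h⟩ else (braidGen n ⟨p.1, h⟩)⁻¹)
    else 1).prod

section ArtinAction

/-- The endomorphism `x_i ↦ x_i x_{i+1} x_i⁻¹`, `x_{i+1} ↦ x_i` of the free group. -/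
def artinHom (i : ℕ) : FreeGroup ℕ →* FreeGroup ℕ :=
  FreeGroup.lift fun j =>
    if j = i then FreeGroup.of i * FreeGroup.of (i + 1) * (FreeGroup.of i)⁻¹
    else if j = i + 1 then FreeGroup.of i else FreeGroup.of j

/-- The endomorphism `x_i ↦ x_{i+1}`, `x_{i+1} ↦ x_{i+1}⁻¹ x_i x_{i+1}` of the free group. -/
def artinInvHom (i : ℕ) : FreeGroup ℕ →* FreeGroup ℕ :=
  FreeGroup.lift fun j =>
    if j = i then FreeGroup.of (i + 1)
    else if j = i + 1 then (FreeGroup.of (i + 1))⁻¹ * FreeGroup.of i * FreeGroup.of (i + 1)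
    else FreeGroup.of j

/-- The Artin automorphism of the free group attached to the `i`-th braid generator. -/
def artinAut (i : ℕ) : MulAut (FreeGroup ℕ) :=
  MonoidHom.toMulEquiv (artinHom i) (artinInvHom i)
    (by
      ext j
      by_cases h : j = i
      · simp [artinHom, artinInvHom, h, mul_assoc]
      · by_cases h' : j = i + 1 <;> simp [artinHom, artinInvHom, h, h'])
    (by
      ext j
      by_cases h : j = i
      · simp [artinHom, artinInvHom, h]
      · by_cases h' : j = i + 1 <;> simp [artinHom, artinInvHom, h, h', mul_assoc])

theorem artinAut_of (i j : ℕ) :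
    artinAut i (FreeGroup.of j) =
      if j = i then FreeGroup.of i * FreeGroup.of (i + 1) * (FreeGroup.of i)⁻¹
      else if j = i + 1 then FreeGroup.of i else FreeGroup.of j := by
  simp [artinAut, artinHom]

theorem artinAut_symm_of (i j : ℕ) :
    (artinAut i).symm (FreeGroup.of j) =
      if j = i then FreeGroup.of (i + 1)
      else if j = i + 1 then (FreeGroup.of (i + 1))⁻¹ * FreeGroup.of i * FreeGroup.of (i + 1)
      else FreeGroup.of j := by
  simp [artinAut, artinInvHom]

theorem artinAut_of_self (i : ℕ) : artinAut i (FreeGroup.of i) =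
    FreeGroup.of i * FreeGroup.of (i + 1) * (FreeGroup.of i)⁻¹ := by
  simp [artinAut_of]

theorem artinAut_of_succ (i : ℕ) : artinAut i (FreeGroup.of (i + 1)) = FreeGroup.of i := by
  simp [artinAut_of]

theorem artinAut_of_ne {i j : ℕ} (h : j ≠ i) (h' : j ≠ i + 1) :
    artinAut i (FreeGroup.of j) = FreeGroup.of j := by
  simp [artinAut_of, h, h']

theorem mulAut_freeGroup_ext {f g : MulAut (FreeGroup ℕ)}
    (h : ∀ j, f (FreeGroup.of j) = g (FreeGroup.of j)) : f = g := by
  have : f.toMonoidHom = g.toMonoidHom := by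
    ext j
    exact h j
  ext x
  exact DFunLike.congr_fun this x

theorem mulAut_inv_apply_eq {M : Type*} [Group M] {f : MulAut M} {x y : M} :
    f⁻¹ x = y ↔ x = f y :=
  MulEquiv.symm_apply_eq f

theorem artinAut_comm {i j : ℕ} (h : i + 2 ≤ j) :
    artinAut i * artinAut j = artinAut j * artinAut i := by
  apply mulAut_freeGroup_ext
  intro k
  simp only [MulAut.mul_apply]
  rcases eq_or_ne k i with rfl | h1
  · simp (disch := omega) [artinAut_of_self, artinAut_of_ne]
  rcases eq_or_ne k (i + 1) with rfl | h2
  · simp (disch := omega) [artinAut_of_succ, artinAut_of_ne]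
  rcases eq_or_ne k j with rfl | h3
  · simp (disch := omega) [artinAut_of_self, artinAut_of_ne]
  rcases eq_or_ne k (j + 1) with rfl | h4
  · simp (disch := omega) [artinAut_of_succ, artinAut_of_ne]
  simp (disch := omega) [artinAut_of_ne]

theorem artinAut_braid (i : ℕ) :
    artinAut i * artinAut (i + 1) * artinAut i =
      artinAut (i + 1) * artinAut i * artinAut (i + 1) := by
  apply mulAut_freeGroup_ext
  intro k
  simp only [MulAut.mul_apply]
  rcases eq_or_ne k i with rfl | h1
  · simp (disch := omega) [artinAut_of_self, artinAut_of_succ, artinAut_of_ne, mul_assoc]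
  rcases eq_or_ne k (i + 1) with rfl | h2
  · simp (disch := omega) [artinAut_of_self, artinAut_of_succ, artinAut_of_ne]
  rcases eq_or_ne k (i + 1 + 1) with rfl | h3
  · simp (disch := omega) [artinAut_of_succ, artinAut_of_ne]
  simp (disch := omega) [artinAut_of_ne]

end ArtinAction

section ArtinRelations

variable {G : Type*} [Group G]

/-- The first `N` elements of the sequence `s` satisfy the Artin relations. -/
structure SatisfiesArtin (s : ℕ → G) (N : ℕ) : Prop where
  comm : ∀ {i j : ℕ}, i + 2 ≤ j → j < N → Commute (s i) (s j)
  braid : ∀ {i : ℕ}, i + 1 < N → s i * s (i + 1) * s i = s (i + 1) * s i * s (i + 1)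

/-- The pure braid `s_j ⋯ s_{j+d-1} s_{j+d}² s_{j+d-1}⁻¹ ⋯ s_j⁻¹`, in which strands `j` and
`j + d + 1` wind around each other. -/
def strandLoop (s : ℕ → G) : ℕ → ℕ → G
  | j, 0 => s j * s j
  | j, d + 1 => s j * strandLoop s (j + 1) d * (s j)⁻¹

/-- The descending product `s_{k+d-1} ⋯ s_{k+1} s_k`. -/
def descendingProd (s : ℕ → G) : ℕ → ℕ → G
  | _, 0 => 1
  | k, d + 1 => descendingProd s (k + 1) d * s k

/-- The subgroup generated by the first `m` elements of a sequence. -/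
def initialSubgroup (s : ℕ → G) (m : ℕ) : Subgroup G :=
  Subgroup.closure (s '' Set.Iio m)

/-- The subgroup generated by the loops of strand `m + 1` around the previous strands. -/
def loopSubgroup (s : ℕ → G) (m : ℕ) : Subgroup G :=
  Subgroup.closure {g | ∃ j d, j + d = m ∧ g = strandLoop s j d}

theorem mem_initialSubgroup (s : ℕ → G) {i m : ℕ} (h : i < m) : s i ∈ initialSubgroup s m :=
  Subgroup.subset_closure ⟨i, h, rfl⟩

theorem strandLoop_mem (s : ℕ → G) (j d : ℕ) : strandLoop s j d ∈ loopSubgroup s (j + d) :=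
  Subgroup.subset_closure ⟨j, d, rfl, rfl⟩

namespace SatisfiesArtin

variable {s : ℕ → G} {N : ℕ}

theorem commute_strandLoop_of_lt (hs : SatisfiesArtin s N) {i : ℕ} :
    ∀ {d j : ℕ}, i + 2 ≤ j → j + d < N → Commute (s i) (strandLoop s j d)
  | 0, _, h, hN => (hs.comm h hN).mul_right (hs.comm h hN)
  | _ + 1, _, h, hN =>
    ((hs.comm h (by omega)).mul_right
      (hs.commute_strandLoop_of_lt (by omega) (by omega))).mul_right
        (hs.comm h (by omega)).inv_right

theorem commute_strandLoop_of_gt (hs : SatisfiesArtin s N) {i : ℕ} :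
    ∀ {d j : ℕ}, j < i → i < j + d → j + d < N → Commute (s i) (strandLoop s j d)
  | 0, _, h, h', _ => by omega
  | d + 1, j, h, h', hN => by
    rcases Nat.lt_or_ge (j + 1) i with h1 | h1
    · have hc : Commute (s i) (s j) := (hs.comm (by omega) (by omega)).symm
      exact (hc.mul_right (hs.commute_strandLoop_of_gt h1 (by omega) (by omega))).mul_right
        hc.inv_right
    · obtain rfl : i = j + 1 := by omega
      obtain ⟨d, rfl⟩ : ∃ e, d = e + 1 := ⟨d - 1, by omega⟩
      have hc : Commute (s j) (strandLoop s (j + 2) d) :=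
        hs.commute_strandLoop_of_lt le_rfl (by omega)
      have hx : SemiconjBy (s j * s (j + 1)) (s j) (s (j + 1)) := by
        have := hs.braid (i := j) (by omega)
        simpa only [SemiconjBy, mul_assoc] using this
      have key : strandLoop s j (d + 1 + 1) =
          s j * s (j + 1) * strandLoop s (j + 2) d * (s j * s (j + 1))⁻¹ := by
        simp [strandLoop, mul_assoc]
      rw [key]
      have e : s (j + 1) = s j * s (j + 1) * s j * (s j * s (j + 1))⁻¹ := by
        rw [hx.eq, mul_inv_cancel_right]
      have := (Commute.conj_iff (s j * s (j + 1))).2 hc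
      rwa [← e] at this

theorem strandLoop_mul_four (hs : SatisfiesArtin s N) :
    ∀ {d j : ℕ}, j + 1 + d < N →
      s j * strandLoop s (j + 1) d * s j * strandLoop s (j + 1) d =
        strandLoop s (j + 1) d * s j * strandLoop s (j + 1) d * s j
  | 0, j, hN => by
    have hb := hs.braid (i := j) (by omega)
    simp only [strandLoop]
    generalize s (j + 1) = t at *
    generalize s j = x at *
    have hc : Commute t (x * t * t * x) := by
      calc t * (x * t * t * x) = t * x * t * (t * x) := by simp only [mul_assoc]
        _ = x * t * (x * t * x) := by rw [← hb]; simp only [mul_assoc]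
        _ = x * t * t * x * t := by rw [hb]; simp only [mul_assoc]
    have := (hc.mul_left hc).eq
    simp only [mul_assoc] at this ⊢
    exact this.symm
  | d + 1, j, hN => by
    have hb := hs.braid (i := j) (by omega)
    have ih := hs.strandLoop_mul_four (d := d) (j := j + 1) (by omega)
    have hc : Commute (s j) (strandLoop s (j + 1 + 1) d) :=
      hs.commute_strandLoop_of_lt le_rfl (by omega)
    simp only [strandLoop]
    generalize strandLoop s (j + 1 + 1) d = c at *
    generalize s (j + 1) = t at *
    generalize s j = x at *
    have h1 : t⁻¹ * x * t = x * t * x⁻¹ := by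
      rw [eq_mul_inv_iff_mul_eq, mul_assoc, mul_assoc, inv_mul_eq_iff_eq_mul, ← mul_assoc, hb,
        ← mul_assoc]
    have h2 : x⁻¹ * t⁻¹ * x = t * x⁻¹ * t⁻¹ := by
      rw [eq_mul_inv_iff_mul_eq, eq_mul_inv_iff_mul_eq, mul_assoc, mul_assoc, mul_assoc,
        inv_mul_eq_iff_eq_mul, inv_mul_eq_iff_eq_mul, ← mul_assoc, ← mul_assoc, hb]
    calc x * (t * c * t⁻¹) * x * (t * c * t⁻¹)
        = x * t * c * (t⁻¹ * x * t) * c * t⁻¹ := by simp only [mul_assoc]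
      _ = x * t * (c * x) * t * (x⁻¹ * c) * t⁻¹ := by rw [h1]; simp only [mul_assoc]
      _ = x * t * x * c * t * c * x⁻¹ * t⁻¹ := by
        rw [← hc.eq, hc.inv_left.eq]; simp only [mul_assoc]
      _ = t * x * (t * c * t * c) * x⁻¹ * t⁻¹ := by rw [hb]; simp only [mul_assoc]
      _ = t * x * c * t * c * (t * x⁻¹ * t⁻¹) := by rw [ih]; simp only [mul_assoc]
      _ = t * (x * c) * t * (c * x⁻¹) * t⁻¹ * x := by rw [← h2]; simp only [mul_assoc]
      _ = t * c * (x * t * x⁻¹) * c * t⁻¹ * x := by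
        rw [hc.eq, ← hc.inv_left.eq]; simp only [mul_assoc]
      _ = t * c * t⁻¹ * x * (t * c * t⁻¹) * x := by rw [← h1]; simp only [mul_assoc]

theorem conj_strandLoop_self (hs : SatisfiesArtin s N) {d j : ℕ} (hN : j + 1 + d < N) :
    s j * strandLoop s j (d + 1) * (s j)⁻¹ =
      (strandLoop s j (d + 1))⁻¹ * strandLoop s (j + 1) d * strandLoop s j (d + 1) := by
  have h := hs.strandLoop_mul_four hN
  simp only [strandLoop]
  generalize strandLoop s (j + 1) d = c at *
  generalize s j = x at *
  have h1 : c * x * c = x * c * x * c * x⁻¹ := by rw [h, mul_inv_cancel_right]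
  calc x * (x * c * x⁻¹) * x⁻¹ = x * c⁻¹ * x⁻¹ * (x * c * x * c * x⁻¹) * x⁻¹ := by group
    _ = (x * c * x⁻¹)⁻¹ * c * (x * c * x⁻¹) := by rw [← h1]; group

theorem conj_mem_loopSubgroup (hs : SatisfiesArtin s N) {i m : ℕ} (hi : i < m) (hm : m < N)
    {a : G} (ha : a ∈ loopSubgroup s m) : s i * a * (s i)⁻¹ ∈ loopSubgroup s m := by
  induction ha using Subgroup.closure_induction with
  | one => simp
  | mul a b _ _ ha hb =>
    have := mul_mem ha hb
    rwa [conj_mul] at this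
  | inv a _ ha =>
    have := inv_mem ha
    rwa [conj_inv] at this
  | mem a ha =>
    obtain ⟨j, d, rfl, rfl⟩ := ha
    rcases lt_trichotomy i j with h | rfl | h
    · rcases Nat.lt_or_ge (i + 1) j with h' | h'
      · rw [(hs.commute_strandLoop_of_lt h' hm).eq, mul_inv_cancel_right]
        exact strandLoop_mem s j d
      · obtain rfl : j = i + 1 := by omega
        have := strandLoop_mem s i (d + 1)
        rwa [show i + (d + 1) = i + 1 + d by omega] at this
    · obtain ⟨d, rfl⟩ : ∃ e, d = e + 1 := ⟨d - 1, by omega⟩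
      rw [hs.conj_strandLoop_self (by omega)]
      have h1 := strandLoop_mem s i (d + 1)
      have h2 := strandLoop_mem s (i + 1) d
      rw [show i + 1 + d = i + (d + 1) by omega] at h2
      exact mul_mem (mul_mem (inv_mem h1) h2) h1
    · rw [(hs.commute_strandLoop_of_gt h hi hm).eq, mul_inv_cancel_right]
      exact strandLoop_mem s j d

theorem inv_conj_mem_loopSubgroup (hs : SatisfiesArtin s N) {i m : ℕ} (hi : i < m) (hm : m < N)
    {a : G} (ha : a ∈ loopSubgroup s m) : (s i)⁻¹ * a * s i ∈ loopSubgroup s m := by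
  induction ha using Subgroup.closure_induction with
  | one => simp
  | mul a b _ _ ha hb =>
    have := mul_mem ha hb
    rwa [show (s i)⁻¹ * a * s i * ((s i)⁻¹ * b * s i) = (s i)⁻¹ * (a * b) * s i by group] at this
  | inv a _ ha =>
    have := inv_mem ha
    rwa [show ((s i)⁻¹ * a * s i)⁻¹ = (s i)⁻¹ * a⁻¹ * s i by group] at this
  | mem a ha =>
    obtain ⟨j, d, rfl, rfl⟩ := ha
    rcases lt_trichotomy i j with h | rfl | h
    · rcases Nat.lt_or_ge (i + 1) j with h' | h'
      · rw [mul_assoc, ← (hs.commute_strandLoop_of_lt h' hm).eq, inv_mul_cancel_left]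
        exact strandLoop_mem s j d
      · obtain rfl : j = i + 1 := by omega
        have h1 := strandLoop_mem s i (d + 1)
        have h2 := strandLoop_mem s (i + 1) d
        rw [show i + (d + 1) = i + 1 + d by omega] at h1
        have e := hs.conj_strandLoop_self hm
        have : (s i)⁻¹ * strandLoop s (i + 1) d * s i =
            strandLoop s (i + 1) d * strandLoop s i (d + 1) * (strandLoop s (i + 1) d)⁻¹ := by
          have e' : strandLoop s (i + 1) d = strandLoop s i (d + 1) *
              (s i * strandLoop s i (d + 1) * (s i)⁻¹) * (strandLoop s i (d + 1))⁻¹ := by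
            rw [e]; group
          have e'' : strandLoop s i (d + 1) = s i * strandLoop s (i + 1) d * (s i)⁻¹ := rfl
          rw [e''] at e' ⊢
          generalize strandLoop s (i + 1) d = c at *
          nth_rewrite 1 [e']
          group
        rw [this]
        exact mul_mem (mul_mem h2 h1) (inv_mem h2)
    · obtain ⟨d, rfl⟩ : ∃ e, d = e + 1 := ⟨d - 1, by omega⟩
      have h2 := strandLoop_mem s (i + 1) d
      rw [show i + 1 + d = i + (d + 1) by omega] at h2
      simpa [strandLoop, mul_assoc] using h2
    · rw [mul_assoc, ← (hs.commute_strandLoop_of_gt h hi hm).eq, inv_mul_cancel_left]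
      exact strandLoop_mem s j d

theorem initialSubgroup_le_normalizer (hs : SatisfiesArtin s N) {m : ℕ} (hm : m < N) :
    initialSubgroup s m ≤ Subgroup.normalizer (loopSubgroup s m : Set G) := by
  rw [initialSubgroup, Subgroup.closure_le]
  rintro _ ⟨i, hi, rfl⟩
  refine Subgroup.mem_normalizer_iff.2 fun a => ⟨hs.conj_mem_loopSubgroup hi hm, fun h => ?_⟩
  have := hs.inv_conj_mem_loopSubgroup hi hm h
  simpa [mul_assoc] using this

theorem commute_descendingProd (hs : SatisfiesArtin s N) {i : ℕ} :
    ∀ {d k : ℕ}, i + 2 ≤ k → k + d ≤ N → Commute (s i) (descendingProd s k d)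
  | 0, _, _, _ => Commute.one_right _
  | _ + 1, _, h, hN =>
    (hs.commute_descendingProd (by omega) (by omega)).mul_right (hs.comm h (by omega))

theorem descendingProd_mul (hs : SatisfiesArtin s N) {i : ℕ} :
    ∀ {d k : ℕ}, k ≤ i → i + 1 < k + d → k + d ≤ N →
      descendingProd s k d * s (i + 1) = s i * descendingProd s k d
  | 0, _, _, _, _ => by omega
  | d + 1, k, h, h', hN => by
    rcases h.lt_or_eq with h1 | rfl
    · rw [descendingProd, mul_assoc, (hs.comm (i := k) (j := i + 1) (by omega) (by omega)).eq,
        ← mul_assoc, hs.descendingProd_mul h1 (by omega) (by omega), mul_assoc]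
    · obtain ⟨d, rfl⟩ : ∃ e, d = e + 1 := ⟨d - 1, by omega⟩
      have hc := (hs.commute_descendingProd (i := k) (d := d) (k := k + 1 + 1) le_rfl (by omega)).eq
      have hb := hs.braid (i := k) (by omega)
      simp only [descendingProd]
      calc _ = descendingProd s (k + 1 + 1) d * (s (k + 1) * s k * s (k + 1)) := by
            simp only [mul_assoc]
        _ = s k * descendingProd s (k + 1 + 1) d * s (k + 1) * s k := by
            rw [← hb, hc]; simp only [mul_assoc]
        _ = _ := by simp only [mul_assoc]

theorem descendingProd_mul_sq (hs : SatisfiesArtin s N) :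
    ∀ {d k : ℕ}, k + d < N → ∃ b ∈ initialSubgroup s (k + d) ⊔ loopSubgroup s (k + d),
      descendingProd s (k + 1) d * s k * s k = b * descendingProd s (k + 1) d
  | 0, k, _ => ⟨_, Subgroup.mem_sup_right (strandLoop_mem s k 0), by
      simp [descendingProd, strandLoop]⟩
  | d + 1, k, hN => by
    obtain ⟨b, hb, e⟩ := hs.descendingProd_mul_sq (d := d) (k := k + 1) (by omega)
    have hk : s k ∈ initialSubgroup s (k + 1 + d) ⊔ loopSubgroup s (k + 1 + d) :=
      Subgroup.mem_sup_left (mem_initialSubgroup s (by omega))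
    have hc := hs.commute_descendingProd (i := k) (d := d) (k := k + 1 + 1) le_rfl (by omega)
    have hr := hs.braid (i := k) (by omega)
    rw [show k + (d + 1) = k + 1 + d by omega]
    refine ⟨(s k)⁻¹ * b * s k, mul_mem (mul_mem (inv_mem hk) hb) hk, ?_⟩
    simp only [descendingProd]
    generalize descendingProd s (k + 1 + 1) d = p at *
    generalize s (k + 1) = t at *
    generalize s k = x at *
    have h1 : t * x * x = x⁻¹ * t * t * x * t := by
      calc t * x * x = x⁻¹ * (x * t * x) * x := by group
        _ = x⁻¹ * (t * x * t) * x := by rw [hr]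
        _ = x⁻¹ * t * (x * t * x) := by simp only [mul_assoc]
        _ = x⁻¹ * t * t * x * t := by rw [hr]; simp only [mul_assoc]
    calc p * t * x * x = (p * x⁻¹) * t * t * x * t := by
          rw [mul_assoc p, mul_assoc p, h1]; simp only [mul_assoc]
      _ = x⁻¹ * (p * t * t) * x * t := by rw [← hc.inv_left.eq]; simp only [mul_assoc]
      _ = x⁻¹ * b * (p * x) * t := by rw [e]; simp only [mul_assoc]
      _ = x⁻¹ * b * x * (p * t) := by rw [← hc.eq]; simp only [mul_assoc]

/-- Coset decomposition: every element of the group generated by `s_0, …, s_m` is a product of an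
element of the group generated by `s_0, …, s_{m-1}`, a product of loops of the last strand,
and a descending product. -/
theorem exists_decomposition (hs : SatisfiesArtin s N) {m : ℕ} (hm : m < N) {g : G}
    (hg : g ∈ initialSubgroup s (m + 1)) :
    ∃ h ∈ initialSubgroup s m, ∃ a ∈ loopSubgroup s m, ∃ k d, k + d = m + 1 ∧
      g = h * a * descendingProd s k d := by
  suffices H : ∃ b ∈ initialSubgroup s m ⊔ loopSubgroup s m, ∃ k d, k + d = m + 1 ∧
      g = b * descendingProd s k d by
    obtain ⟨b, hb, k, d, hkd, rfl⟩ := H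
    rw [← SetLike.mem_coe, Subgroup.coe_mul_of_left_le_normalizer_right _ _
      (hs.initialSubgroup_le_normalizer hm)] at hb
    obtain ⟨h, hh, a, ha, rfl⟩ := Set.mem_mul.1 hb
    exact ⟨h, hh, a, ha, k, d, hkd, rfl⟩
  have hK {i : ℕ} (hi : i < m) : s i ∈ initialSubgroup s m ⊔ loopSubgroup s m :=
    Subgroup.mem_sup_left (mem_initialSubgroup s hi)
  induction hg using Subgroup.closure_induction_right with
  | one => exact ⟨1, one_mem _, m + 1, 0, rfl, by simp [descendingProd]⟩
  | mul_right g _ x hx ih =>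
    obtain ⟨i, hi, rfl⟩ := hx
    obtain ⟨b, hb, k, d, hkd, rfl⟩ := ih
    rw [Set.mem_Iio] at hi
    rcases lt_trichotomy i k with h | rfl | h
    · rcases Nat.lt_or_ge (i + 1) k with h' | h'
      · refine ⟨b * s i, mul_mem hb (hK (by omega)), k, d, hkd, ?_⟩
        rw [mul_assoc, ← (hs.commute_descendingProd h' (by omega)).eq, mul_assoc]
      · obtain rfl : k = i + 1 := by omega
        exact ⟨b, hb, i, d + 1, by omega, by rw [descendingProd, mul_assoc]⟩
    · obtain ⟨d, rfl⟩ : ∃ e, d = e + 1 := ⟨d - 1, by omega⟩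
      obtain rfl : m = i + d := by omega
      obtain ⟨c, hc, e⟩ := hs.descendingProd_mul_sq hm
      exact ⟨b * c, mul_mem hb hc, i + 1, d, by omega, by
        rw [descendingProd, mul_assoc, e, mul_assoc]⟩
    · obtain ⟨i, rfl⟩ : ∃ e, i = e + 1 := ⟨i - 1, by omega⟩
      refine ⟨b * s i, mul_mem hb (hK (by omega)), k, d, hkd, ?_⟩
      rw [mul_assoc, hs.descendingProd_mul (by omega) (by omega) (by omega), mul_assoc]
  | mul_inv_cancel g _ x hx ih =>
    obtain ⟨i, hi, rfl⟩ := hx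
    obtain ⟨b, hb, k, d, hkd, rfl⟩ := ih
    rw [Set.mem_Iio] at hi
    rcases lt_trichotomy i k with h | rfl | h
    · rcases Nat.lt_or_ge (i + 1) k with h' | h'
      · refine ⟨b * (s i)⁻¹, mul_mem hb (inv_mem (hK (by omega))), k, d, hkd, ?_⟩
        rw [mul_assoc, ← (hs.commute_descendingProd h' (by omega)).inv_left.eq, mul_assoc]
      · obtain rfl : k = i + 1 := by omega
        obtain rfl : m = i + d := by omega
        obtain ⟨c, hc, e⟩ := hs.descendingProd_mul_sq hm
        refine ⟨b * c⁻¹, mul_mem hb (inv_mem hc), i, d + 1, by omega, ?_⟩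
        have e' : descendingProd s (i + 1) d * (s i)⁻¹ =
            c⁻¹ * (descendingProd s (i + 1) d * s i) := by
          rw [eq_inv_mul_iff_mul_eq, ← mul_assoc, ← e, mul_inv_cancel_right]
        rw [mul_assoc, e', descendingProd, mul_assoc]
    · obtain ⟨d, rfl⟩ : ∃ e, d = e + 1 := ⟨d - 1, by omega⟩
      exact ⟨b, hb, i + 1, d, by omega, by simp [descendingProd, mul_assoc]⟩
    · obtain ⟨i, rfl⟩ : ∃ e, i = e + 1 := ⟨i - 1, by omega⟩
      refine ⟨b * (s i)⁻¹, mul_mem hb (inv_mem (hK (by omega))), k, d, hkd, ?_⟩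
      have e := hs.descendingProd_mul (i := i) (k := k) (d := d) (by omega) (by omega) (by omega)
      have e' : descendingProd s k d * (s (i + 1))⁻¹ = (s i)⁻¹ * descendingProd s k d := by
        rw [eq_inv_mul_iff_mul_eq, ← mul_assoc, ← e, mul_inv_cancel_right]
      rw [mul_assoc, e', mul_assoc]

end SatisfiesArtin
end ArtinRelations

section Faithfulness

/-- The retraction of the free group killing the generator `x_k`. -/
def killGen (k : ℕ) : FreeGroup ℕ →* FreeGroup ℕ :=
  FreeGroup.lift fun j => if j = k then 1 else FreeGroup.of j

/-- The exponent sum of the generator `x_k`. -/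
def exponentSum (k : ℕ) : FreeGroup ℕ →* Multiplicative ℤ :=
  FreeGroup.lift fun j => if j = k then Multiplicative.ofAdd 1 else 1

theorem killGen_of (k j : ℕ) :
    killGen k (FreeGroup.of j) = if j = k then 1 else FreeGroup.of j := by
  simp [killGen]

theorem killGen_of_self (k : ℕ) : killGen k (FreeGroup.of k) = 1 := by
  simp [killGen_of]

theorem killGen_of_ne {k j : ℕ} (h : j ≠ k) : killGen k (FreeGroup.of j) = FreeGroup.of j := by
  simp [killGen_of, h]

theorem exponentSum_of (k j : ℕ) :
    exponentSum k (FreeGroup.of j) = if j = k then Multiplicative.ofAdd 1 else 1 := by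
  simp [exponentSum]

/-- An element commuting with the generator `x_k` becomes trivial when `x_k` is killed. -/
theorem killGen_eq_one_of_commute {k : ℕ} {u : FreeGroup ℕ} (h : Commute u (FreeGroup.of k)) :
    killGen k u = 1 := by
  classical
  let f : FreeGroup ℕ →* Equiv.Perm (FreeGroup ℕ × Bool) :=
    FreeGroup.lift fun j =>
      if j = k then Equiv.swap (1, false) (1, true)
      else (Equiv.mulLeft (FreeGroup.of j)).prodCongr (Equiv.refl Bool)
  have hfst : ∀ x p, (f x p).1 = killGen k x * p.1 := by
    intro x
    induction x using FreeGroup.induction_on with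
    | C1 => simp
    | of j =>
      intro p
      by_cases hj : j = k
      · simp only [f, FreeGroup.lift_apply_of, hj, if_true, killGen_of_self, one_mul]
        rw [Equiv.swap_apply_def]
        split_ifs with h1 h2 <;> simp [*]
      · simp [f, hj, killGen_of_ne hj]
    | inv_of j ih =>
      intro p
      have := ih ((f (FreeGroup.of j))⁻¹ p)
      rw [← Equiv.Perm.mul_apply, mul_inv_cancel, Equiv.Perm.one_apply] at this
      rw [map_inv, map_inv, this, inv_mul_cancel_left]
    | mul x y hx hy =>
      intro p
      rw [map_mul, map_mul, Equiv.Perm.mul_apply, hx, hy, mul_assoc]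
  have hk : f (FreeGroup.of k) = Equiv.swap (1, false) (1, true) := by simp [f]
  by_contra hne
  have hne' : ∀ b c : Bool, f u (1, b) ≠ (1, c) := fun b c e => hne <| by
    have := hfst u (1, b)
    rw [e] at this
    simpa using this.symm
  have e : f u (f (FreeGroup.of k) (1, false)) = f (FreeGroup.of k) (f u (1, false)) := by
    rw [← Equiv.Perm.mul_apply, ← Equiv.Perm.mul_apply, ← map_mul, ← map_mul, h.eq]
  rw [hk, Equiv.swap_apply_left, Equiv.swap_apply_of_ne_of_ne (hne' _ _) (hne' _ _)] at e
  simpa using (f u).injective e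

variable {G : Type*} [Group G] (ρ : G →* MulAut (FreeGroup ℕ))

/-- The elements whose action preserves a given homomorphism out of the free group. -/
def invariantSubgroup {M : Type*} [Group M] (f : FreeGroup ℕ →* M) : Subgroup G where
  carrier := {g | ∀ x, f (ρ g x) = f x}
  one_mem' := by simp
  mul_mem' {a b} ha hb x := by rw [map_mul, MulAut.mul_apply, ha, hb]
  inv_mem' {a} ha x := by
    rw [← ha, map_inv, MulAut.apply_inv_self]

variable {ρ}

theorem mem_invariantSubgroup {M : Type*} [Group M] {f : FreeGroup ℕ →* M} {g : G} :
    g ∈ invariantSubgroup ρ f ↔ ∀ x, f (ρ g x) = f x :=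
  Iff.rfl

theorem freeGroup_hom_comp_ext {M : Type*} [Group M] {f f' : FreeGroup ℕ →* M}
    (h : ∀ j, f (FreeGroup.of j) = f' (FreeGroup.of j)) (x : FreeGroup ℕ) : f x = f' x :=
  DFunLike.congr_fun (FreeGroup.ext_hom _ _ h) x

variable {s : ℕ → G} {N : ℕ}

theorem apply_of_of_lt (hρ : ∀ i < N, ρ (s i) = artinAut i) {m k : ℕ} (hm : m ≤ N) (hk : m < k)
    {g : G} (hg : g ∈ initialSubgroup s m) : ρ g (FreeGroup.of k) = FreeGroup.of k := by
  induction hg using Subgroup.closure_induction with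
  | one => simp
  | mem x hx =>
    obtain ⟨i, hi, rfl⟩ := hx
    rw [Set.mem_Iio] at hi
    rw [hρ i (by omega), artinAut_of_ne (by omega) (by omega)]
  | mul x y _ _ hx hy => rw [map_mul, MulAut.mul_apply, hy, hx]
  | inv x _ hx => rw [map_inv, mulAut_inv_apply_eq, hx]

theorem killGen_apply (hρ : ∀ i < N, ρ (s i) = artinAut i) {m : ℕ} (hm : m ≤ N)
    {g : G} (hg : g ∈ initialSubgroup s m) :
    ∀ x, killGen (m + 1) (ρ g x) = ρ g (killGen (m + 1) x) := by
  induction hg using Subgroup.closure_induction with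
  | one => simp
  | mem g hg =>
    obtain ⟨i, hi, rfl⟩ := hg
    rw [Set.mem_Iio] at hi
    rw [hρ i (by omega)]
    refine freeGroup_hom_comp_ext (f := (killGen (m + 1)).comp (artinAut i).toMonoidHom)
      (f' := (artinAut i).toMonoidHom.comp (killGen (m + 1))) fun j => ?_
    simp only [MonoidHom.comp_apply, MulEquiv.toMonoidHom_eq_coe, MonoidHom.coe_coe]
    rcases eq_or_ne j i with rfl | h1
    · simp (disch := omega) [artinAut_of_self, killGen_of_ne]
    rcases eq_or_ne j (i + 1) with rfl | h2
    · simp (disch := omega) [artinAut_of_succ, killGen_of_ne]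
    rcases eq_or_ne j (m + 1) with rfl | h3
    · simp (disch := omega) [artinAut_of_ne, killGen_of_self]
    simp (disch := omega) [artinAut_of_ne, killGen_of_ne]
  | mul a b _ _ ha hb => intro x; rw [map_mul, MulAut.mul_apply, ha, hb, MulAut.mul_apply]
  | inv a _ ha =>
    intro x
    have := ha ((ρ a)⁻¹ x)
    rw [MulAut.apply_inv_self] at this
    rw [map_inv, this, MulAut.inv_apply_self]

theorem strandLoop_mem_invariantSubgroup_killGen (hρ : ∀ i < N, ρ (s i) = artinAut i) :
    ∀ {d j : ℕ}, j + d < N → strandLoop s j d ∈ invariantSubgroup ρ (killGen (j + d + 1))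
  | 0, j, h => by
    intro x
    rw [strandLoop, map_mul, hρ j h, add_zero]
    refine freeGroup_hom_comp_ext
      (f := (killGen (j + 1)).comp (artinAut j * artinAut j).toMonoidHom) (fun k => ?_) x
    simp only [MonoidHom.comp_apply, MulEquiv.toMonoidHom_eq_coe, MonoidHom.coe_coe,
      MulAut.mul_apply]
    rcases eq_or_ne k j with rfl | h1
    · simp (disch := omega) [artinAut_of_self, artinAut_of_succ, killGen_of_self, killGen_of_ne]
    rcases eq_or_ne k (j + 1) with rfl | h2
    · simp (disch := omega) [artinAut_of_self, artinAut_of_succ, killGen_of_self, killGen_of_ne]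
    simp (disch := omega) [artinAut_of_ne]
  | d + 1, j, h => by
    have ih := strandLoop_mem_invariantSubgroup_killGen hρ (d := d) (j := j + 1) (by omega)
    have hj : s j ∈ initialSubgroup s (j + (d + 1)) := mem_initialSubgroup s (by omega)
    rw [show j + 1 + d = j + (d + 1) by omega] at ih
    intro x
    rw [strandLoop, map_mul, map_mul, MulAut.mul_apply, MulAut.mul_apply,
      killGen_apply hρ (by omega) hj, mem_invariantSubgroup.1 ih,
      ← killGen_apply hρ (by omega) hj, map_inv, MulAut.apply_inv_self]

theorem strandLoop_apply_of (hρ : ∀ i < N, ρ (s i) = artinAut i) :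
    ∀ {d j : ℕ}, j + d < N → ρ (strandLoop s j d) (FreeGroup.of (j + d + 1)) =
      FreeGroup.of j * FreeGroup.of (j + d + 1) * (FreeGroup.of j)⁻¹
  | 0, j, h => by
    rw [strandLoop, map_mul, hρ j h, MulAut.mul_apply, add_zero, artinAut_of_succ,
      artinAut_of_self]
  | d + 1, j, h => by
    have ih := strandLoop_apply_of hρ (d := d) (j := j + 1) (by omega)
    have hj : ρ (s j) (FreeGroup.of (j + (d + 1) + 1)) = FreeGroup.of (j + (d + 1) + 1) := by
      rw [hρ j (by omega), artinAut_of_ne (by omega) (by omega)]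
    rw [show j + 1 + d = j + (d + 1) by omega] at ih
    rw [strandLoop, map_mul, map_mul, MulAut.mul_apply, MulAut.mul_apply, map_inv,
      mulAut_inv_apply_eq.2 hj.symm, ih, map_mul, map_mul, map_inv, hj, hρ j (by omega),
      artinAut_of_succ]

theorem loopSubgroup_le_invariantSubgroup_killGen (hρ : ∀ i < N, ρ (s i) = artinAut i)
    {m : ℕ} (hm : m < N) : loopSubgroup s m ≤ invariantSubgroup ρ (killGen (m + 1)) := by
  rw [loopSubgroup, Subgroup.closure_le]
  rintro _ ⟨j, d, rfl, rfl⟩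
  exact strandLoop_mem_invariantSubgroup_killGen hρ hm

theorem exists_conj_of_mem_loopSubgroup (hρ : ∀ i < N, ρ (s i) = artinAut i) {m : ℕ} (hm : m < N)
    {a : G} (ha : a ∈ loopSubgroup s m) :
    ∃ u : FreeGroup ℕ, ρ a (FreeGroup.of (m + 1)) = u * FreeGroup.of (m + 1) * u⁻¹ ∧
      FreeGroup.lift (fun j => (strandLoop s j (m - j))⁻¹) (killGen (m + 1) u) = a⁻¹ := by
  have hinv := loopSubgroup_le_invariantSubgroup_killGen hρ hm
  induction ha using Subgroup.closure_induction with
  | one => exact ⟨1, by simp, by simp⟩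
  | mem a ha =>
    obtain ⟨j, d, rfl, rfl⟩ := ha
    refine ⟨FreeGroup.of j, strandLoop_apply_of hρ hm, ?_⟩
    rw [killGen_of_ne (by omega), FreeGroup.lift_apply_of, Nat.add_sub_cancel_left]
  | mul a b ha hb iha ihb =>
    obtain ⟨u, hu, hu'⟩ := iha
    obtain ⟨v, hv, hv'⟩ := ihb
    refine ⟨ρ a v * u, ?_, ?_⟩
    · rw [map_mul, MulAut.mul_apply, hv, map_mul, map_mul, hu, map_inv]
      group
    · rw [map_mul, mem_invariantSubgroup.1 (hinv ha), map_mul, hu', hv', mul_inv_rev]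
  | inv a ha iha =>
    obtain ⟨u, hu, hu'⟩ := iha
    have ha' : a⁻¹ ∈ loopSubgroup s m := inv_mem ha
    refine ⟨(ρ a⁻¹ u)⁻¹, ?_, ?_⟩
    · rw [map_inv, mulAut_inv_apply_eq, map_mul, map_mul, map_inv, inv_inv,
        MulAut.apply_inv_self, hu]
      group
    · rw [map_inv, mem_invariantSubgroup.1 (hinv ha'), map_inv, hu']

theorem exponentSum_artinAut (i k : ℕ) (x : FreeGroup ℕ) :
    exponentSum k (artinAut i x) = exponentSum (Equiv.swap i (i + 1) k) x := by
  refine freeGroup_hom_comp_ext (f := (exponentSum k).comp (artinAut i).toMonoidHom)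
    (fun j => ?_) x
  simp only [MonoidHom.comp_apply, MulEquiv.toMonoidHom_eq_coe, MonoidHom.coe_coe]
  rw [artinAut_of, Equiv.swap_apply_def]
  split_ifs <;> subst_vars <;> simp [exponentSum_of] <;> grind

theorem initialSubgroup_le_invariantSubgroup_exponentSum (hρ : ∀ i < N, ρ (s i) = artinAut i)
    {m : ℕ} (hm : m ≤ N) : initialSubgroup s m ≤ invariantSubgroup ρ (exponentSum (m + 1)) := by
  rw [initialSubgroup, Subgroup.closure_le]
  rintro _ ⟨i, hi, rfl⟩ x
  rw [Set.mem_Iio] at hi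
  rw [hρ i (by omega), exponentSum_artinAut, Equiv.swap_apply_of_ne_of_ne (by omega) (by omega)]

theorem strandLoop_mem_invariantSubgroup_exponentSum (hρ : ∀ i < N, ρ (s i) = artinAut i) :
    ∀ {d j : ℕ}, j + d < N → strandLoop s j d ∈ invariantSubgroup ρ (exponentSum (j + d + 1))
  | 0, j, h => fun x => by
    rw [strandLoop, map_mul, hρ j h, MulAut.mul_apply, exponentSum_artinAut, exponentSum_artinAut,
      Equiv.swap_apply_self, add_zero]
  | d + 1, j, h => by
    have ih := strandLoop_mem_invariantSubgroup_exponentSum hρ (d := d) (j := j + 1) (by omega)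
    have hj := initialSubgroup_le_invariantSubgroup_exponentSum hρ (m := j + (d + 1)) (by omega)
      (mem_initialSubgroup s (i := j) (by omega))
    rw [show j + 1 + d = j + (d + 1) by omega] at ih
    exact mul_mem (mul_mem hj ih) (inv_mem hj)

theorem exponentSum_descendingProd (hρ : ∀ i < N, ρ (s i) = artinAut i) :
    ∀ {d k : ℕ}, k + d ≤ N → ∀ x,
      exponentSum (k + d) (ρ (descendingProd s k d) x) = exponentSum k x
  | 0, k, _, x => by simp [descendingProd]
  | d + 1, k, h, x => by
    rw [descendingProd, map_mul, MulAut.mul_apply, show k + (d + 1) = k + 1 + d by omega,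
      exponentSum_descendingProd hρ (by omega), hρ k (by omega), exponentSum_artinAut,
      Equiv.swap_apply_right]

/-- Faithfulness of the Artin representation of the braid group on the free group. -/
theorem SatisfiesArtin.eq_one_of_apply_eq_one (hs : SatisfiesArtin s N)
    (hρ : ∀ i < N, ρ (s i) = artinAut i) {m : ℕ} (hm : m ≤ N) {g : G}
    (hg : g ∈ initialSubgroup s m) (h : ρ g = 1) : g = 1 := by
  induction m generalizing g with
  | zero => simpa [initialSubgroup] using hg
  | succ m ih =>
    obtain ⟨b, hb, a, ha, k, d, hkd, rfl⟩ := hs.exists_decomposition hm hg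
    have hd : d = 0 := by
      have hba : b * a ∈ invariantSubgroup ρ (exponentSum (m + 1)) := by
        refine mul_mem (initialSubgroup_le_invariantSubgroup_exponentSum hρ (by omega) hb)
          ((Subgroup.closure_le _).2 ?_ ha)
        rintro _ ⟨j, d, rfl, rfl⟩
        exact strandLoop_mem_invariantSubgroup_exponentSum hρ hm
      have e := exponentSum_descendingProd hρ (d := d) (k := k) (by omega) (FreeGroup.of k)
      rw [hkd, ← mem_invariantSubgroup.1 hba, ← MulAut.mul_apply, ← map_mul, h, MulAut.one_apply,
        exponentSum_of, exponentSum_of, if_pos rfl] at e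
      by_contra hd
      rw [if_neg (by omega)] at e
      exact absurd e (by decide)
    subst hd
    rw [descendingProd, mul_one] at h ⊢
    have hk : ∀ x, killGen (m + 1) x = ρ b (killGen (m + 1) x) := fun x => by
      rw [← mem_invariantSubgroup.1 (loopSubgroup_le_invariantSubgroup_killGen hρ hm ha),
        ← killGen_apply hρ (by omega) hb, ← MulAut.mul_apply, ← map_mul, h, MulAut.one_apply,
        mem_invariantSubgroup.1 (loopSubgroup_le_invariantSubgroup_killGen hρ hm ha)]
    have hb1 : b = 1 := by
      refine ih (by omega) hb (mulAut_freeGroup_ext fun j => ?_)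
      rw [MulAut.one_apply]
      rcases eq_or_ne j (m + 1) with rfl | hj
      · exact apply_of_of_lt hρ (by omega) (by omega) hb
      · have := hk (FreeGroup.of j)
        rw [killGen_of_ne hj] at this
        exact this.symm
    subst hb1
    rw [one_mul] at h ⊢
    obtain ⟨u, hu, hu'⟩ := exists_conj_of_mem_loopSubgroup hρ hm ha
    rw [h, MulAut.one_apply, eq_mul_inv_iff_mul_eq] at hu
    rw [killGen_eq_one_of_commute hu.symm, map_one] at hu'
    exact (inv_eq_one.1 hu'.symm)

end Faithfulness

section Algorithm

/-- The word representing the image of the letter `q` under the Artin automorphism, or its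
inverse, attached to the braid letter `p`. -/
def artinSubst (p q : ℕ × Bool) : List (ℕ × Bool) :=
  if q.1 = p.1 then
    if p.2 = true then [(p.1, true), (p.1 + 1, q.2), (p.1, false)] else [(p.1 + 1, q.2)]
  else if q.1 = p.1 + 1 then
    if p.2 = true then [(p.1, q.2)] else [(p.1 + 1, false), (p.1, q.2), (p.1 + 1, true)]
  else [q]

/-- A word representing the image of `x_k` under the Artin action of the braid word `w`. -/
def artinImage (w : List (ℕ × Bool)) (k : ℕ) : List (ℕ × Bool) :=
  w.foldr (fun p L => L.flatMap (artinSubst p)) [(k, true)]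

/-- The decision procedure: test whether the Artin action fixes the first `n` free generators. -/
def braidWordTest (x : ℕ × List (ℕ × Bool)) : Bool :=
  decide (((List.range x.1).map fun k => FreeGroup.reduce (artinImage x.2 k)) =
    (List.range x.1).map fun k => [(k, true)])

theorem primrec_artinSubst : Primrec₂ artinSubst := by
  have p1 : Primrec fun x : (ℕ × Bool) × (ℕ × Bool) => x.1.1 := Primrec.fst.comp Primrec.fst
  have p2 : Primrec fun x : (ℕ × Bool) × (ℕ × Bool) => x.1.2 := Primrec.snd.comp Primrec.fst
  have q1 : Primrec fun x : (ℕ × Bool) × (ℕ × Bool) => x.2.1 := Primrec.fst.comp Primrec.snd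
  have q2 : Primrec fun x : (ℕ × Bool) × (ℕ × Bool) => x.2.2 := Primrec.snd.comp Primrec.snd
  have s1 := Primrec.succ.comp p1
  have hε : PrimrecPred fun x : (ℕ × Bool) × (ℕ × Bool) => x.1.2 = true :=
    Primrec.eq.comp p2 (Primrec.const true)
  have nil : Primrec fun _ : (ℕ × Bool) × (ℕ × Bool) => ([] : List (ℕ × Bool)) := Primrec.const []
  refine Primrec.ite (Primrec.eq.comp q1 p1) (Primrec.ite hε ?_ ?_)
    (Primrec.ite (Primrec.eq.comp q1 s1) (Primrec.ite hε ?_ ?_) ?_)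
  · exact Primrec.list_cons.comp (p1.pair (Primrec.const true)) <|
      Primrec.list_cons.comp (s1.pair q2) <|
        Primrec.list_cons.comp (p1.pair (Primrec.const false)) nil
  · exact Primrec.list_cons.comp (s1.pair q2) nil
  · exact Primrec.list_cons.comp (p1.pair q2) nil
  · exact Primrec.list_cons.comp (s1.pair (Primrec.const false)) <|
      Primrec.list_cons.comp (p1.pair q2) <|
        Primrec.list_cons.comp (s1.pair (Primrec.const true)) nil
  · exact Primrec.list_cons.comp Primrec.snd nil

theorem primrec_freeGroup_reduce {α : Type*} [Primcodable α] [DecidableEq α] :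
    Primrec (FreeGroup.reduce : List (α × Bool) → List (α × Bool)) := by
  have y1 : Primrec fun z : List (α × Bool) × ((α × Bool) × List (α × Bool)) => z.2.1 :=
    Primrec.fst.comp Primrec.snd
  have h1 := y1.comp (Primrec.fst (β := (α × Bool) × List (α × Bool)))
  have hd : Primrec fun z : (List (α × Bool) × ((α × Bool) × List (α × Bool))) ×
      ((α × Bool) × List (α × Bool)) => z.2.1 := Primrec.fst.comp Primrec.snd
  have tl : Primrec fun z : (List (α × Bool) × ((α × Bool) × List (α × Bool))) ×
      ((α × Bool) × List (α × Bool)) => z.2.2 := Primrec.snd.comp Primrec.snd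
  have cancel : Primrec₂ fun (z : List (α × Bool) × ((α × Bool) × List (α × Bool)))
      (y : (α × Bool) × List (α × Bool)) =>
      if z.2.1.1 = y.1.1 ∧ z.2.1.2 = !y.1.2 then y.2 else z.2.1 :: y.1 :: y.2 :=
    Primrec.ite (PrimrecPred.and
      (Primrec.eq.comp (Primrec.fst.comp h1) (Primrec.fst.comp hd))
      (Primrec.eq.comp (Primrec.snd.comp h1) (Primrec.not.comp (Primrec.snd.comp hd)))) tl
      (Primrec.list_cons.comp h1 (Primrec.list_cons.comp hd tl))
  have step : Primrec₂ fun (_ : List (α × Bool)) (y : (α × Bool) × List (α × Bool)) =>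
      (List.casesOn y.2 [y.1] fun hd tl =>
        if y.1.1 = hd.1 ∧ y.1.2 = !hd.2 then tl else y.1 :: hd :: tl : List (α × Bool)) :=
    Primrec.list_casesOn
      (f := fun z : List (α × Bool) × ((α × Bool) × List (α × Bool)) => z.2.2)
      (g := fun z => [z.2.1]) (Primrec.snd.comp Primrec.snd)
      (Primrec.list_cons.comp y1 (Primrec.const [])) cancel
  refine (Primrec.list_foldr Primrec.id (Primrec.const []) step).of_eq fun L => ?_
  induction L with
  | nil => rfl
  | cons x L ih =>
    rw [FreeGroup.reduce.cons, ← ih]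
    rfl

theorem primrec_artinImage : Primrec₂ artinImage := by
  have hinit : Primrec fun x : List (ℕ × Bool) × ℕ => [(x.2, true)] :=
    Primrec.list_cons.comp (Primrec.snd.pair (Primrec.const true)) (Primrec.const [])
  have hstep : Primrec₂ fun (_ : List (ℕ × Bool) × ℕ) (y : (ℕ × Bool) × List (ℕ × Bool)) =>
      y.2.flatMap (artinSubst y.1) :=
    Primrec.list_flatMap (Primrec.snd.comp Primrec.snd)
      (primrec_artinSubst.comp (Primrec.fst.comp (Primrec.snd.comp Primrec.fst)) Primrec.snd)
  exact Primrec.list_foldr Primrec.fst hinit hstep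

theorem primrec_braidWordTest : Primrec braidWordTest := by
  refine (Primrec.eq.comp (Primrec.list_map (Primrec.list_range.comp Primrec.fst) ?_)
    (Primrec.list_map (Primrec.list_range.comp Primrec.fst) ?_)).decide
  · exact primrec_freeGroup_reduce.comp
      (primrec_artinImage.comp (Primrec.snd.comp Primrec.fst) Primrec.snd)
  · exact Primrec.list_cons.comp (Primrec.snd.pair (Primrec.const true)) (Primrec.const [])

/-- The Artin automorphism attached to a braid letter. -/
def artinLetterAut (p : ℕ × Bool) : MulAut (FreeGroup ℕ) :=
  if p.2 = true then artinAut p.1 else (artinAut p.1)⁻¹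

theorem mk_artinSubst (p q : ℕ × Bool) :
    FreeGroup.mk (artinSubst p q) = artinLetterAut p (FreeGroup.mk [q]) := by
  have hof (k : ℕ) : FreeGroup.mk [(k, true)] = FreeGroup.of k := rfl
  have hinv (k : ℕ) : FreeGroup.mk [(k, false)] = (FreeGroup.of k)⁻¹ := rfl
  have hcons (x y : ℕ × Bool) (L : List (ℕ × Bool)) :
      FreeGroup.mk (x :: y :: L) = FreeGroup.mk [x] * FreeGroup.mk (y :: L) := rfl
  obtain ⟨i, ε⟩ := p
  obtain ⟨j, δ⟩ := q
  simp only [artinSubst, artinLetterAut]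
  rcases ε <;> rcases δ <;> split_ifs <;>
    simp_all [artinAut_of, artinAut_symm_of, mul_assoc, -FreeGroup.mul_mk]

theorem mk_flatMap_artinSubst (p : ℕ × Bool) (L : List (ℕ × Bool)) :
    FreeGroup.mk (L.flatMap (artinSubst p)) = artinLetterAut p (FreeGroup.mk L) := by
  induction L with
  | nil => exact (map_one (artinLetterAut p)).symm
  | cons q L ih =>
    rw [List.flatMap_cons, ← FreeGroup.mul_mk, ih, mk_artinSubst, ← map_mul, FreeGroup.mul_mk,
      List.singleton_append]

theorem mk_artinImage (w : List (ℕ × Bool)) (k : ℕ) :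
    FreeGroup.mk (artinImage w k) = (w.map artinLetterAut).prod (FreeGroup.of k) := by
  induction w with
  | nil => rfl
  | cons p w ih =>
    rw [List.map_cons, List.prod_cons, MulAut.mul_apply, ← ih, ← mk_flatMap_artinSubst]
    rfl

theorem braidWordTest_eq_true_iff (n : ℕ) (w : List (ℕ × Bool)) :
    braidWordTest (n, w) = true ↔
      ∀ k < n, (w.map artinLetterAut).prod (FreeGroup.of k) = FreeGroup.of k := by
  rw [braidWordTest, decide_eq_true_iff, List.map_inj_left]
  simp only [List.mem_range]
  refine forall₂_congr fun k _ => ?_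
  rw [← mk_artinImage]
  exact ⟨fun h => FreeGroup.reduce.exact (L₂ := [(k, true)]) h,
    fun h => FreeGroup.reduce.sound (L₂ := [(k, true)]) h⟩

end Algorithm

section BraidGroup

/-- The Artin generators of the braid group, extended by `1` to all natural indices. -/
def braidGenNat (n i : ℕ) : BraidGroup n :=
  if h : i < n - 1 then braidGen n ⟨i, h⟩ else 1

theorem braidGenNat_of_lt {n i : ℕ} (h : i < n - 1) : braidGenNat n i = braidGen n ⟨i, h⟩ :=
  dif_pos h

theorem satisfiesArtin_braidGenNat (n : ℕ) : SatisfiesArtin (braidGenNat n) (n - 1) where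
  comm {i j} h hj := by
    rw [braidGenNat_of_lt hj, braidGenNat_of_lt (show i < n - 1 by omega)]
    have := PresentedGroup.one_of_mem (rels := artinRels n) (Or.inl
      ⟨⟨i, by omega⟩, ⟨j, hj⟩, Or.inl h, rfl⟩)
    simp only [map_mul, map_inv] at this
    exact mul_inv_eq_iff_eq_mul.1 (mul_inv_eq_one.1 this)
  braid {i} h := by
    rw [braidGenNat_of_lt h, braidGenNat_of_lt (show i < n - 1 by omega)]
    have := PresentedGroup.one_of_mem (rels := artinRels n) (Or.inr
      ⟨⟨i, by omega⟩, ⟨i + 1, h⟩, Or.inl rfl, rfl⟩)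
    simp only [map_mul, map_inv] at this
    exact mul_inv_eq_one.1 this

theorem artinAut_eq_one_of_mem_artinRels (n : ℕ) :
    ∀ r ∈ artinRels n, FreeGroup.lift (fun i : Fin (n - 1) => artinAut i) r = 1 := by
  rintro r (⟨i, j, h, rfl⟩ | ⟨i, j, h, rfl⟩)
  · have e : artinAut i * artinAut j = artinAut j * artinAut i :=
      h.elim artinAut_comm fun h => (artinAut_comm h).symm
    simp [e]
  · have e : artinAut i * artinAut j * artinAut i = artinAut j * artinAut i * artinAut j := by
      rcases h with h | h
      · rw [← h]
        exact artinAut_braid i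
      · rw [← h]
        exact (artinAut_braid j).symm
    simp only [map_mul, map_inv, FreeGroup.lift_apply_of, e, mul_inv_cancel]

/-- The Artin representation of the braid group. -/
def artinRep (n : ℕ) : BraidGroup n →* MulAut (FreeGroup ℕ) :=
  PresentedGroup.toGroup (artinAut_eq_one_of_mem_artinRels n)

theorem artinRep_braidGenNat {n i : ℕ} (h : i < n - 1) :
    artinRep n (braidGenNat n i) = artinAut i := by
  rw [braidGenNat_of_lt h]
  exact PresentedGroup.toGroup.of (artinAut_eq_one_of_mem_artinRels n)

theorem evalWordNat_cons (n : ℕ) (p : ℕ × Bool) (w : List (ℕ × Bool)) (h : p.1 < n - 1) :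
    evalWordNat n (p :: w) =
      (if p.2 = true then braidGenNat n p.1 else (braidGenNat n p.1)⁻¹) * evalWordNat n w := by
  simp [evalWordNat, h, braidGenNat_of_lt]

theorem evalWordNat_mem (n : ℕ) {w : List (ℕ × Bool)} (hw : ∀ p ∈ w, p.1 < n - 1) :
    evalWordNat n w ∈ initialSubgroup (braidGenNat n) (n - 1) := by
  induction w with
  | nil => exact one_mem _
  | cons p w ih =>
    rw [List.forall_mem_cons] at hw
    rw [evalWordNat_cons n p w hw.1]
    have := mem_initialSubgroup (braidGenNat n) hw.1
    refine mul_mem ?_ (ih hw.2)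
    split_ifs
    exacts [this, inv_mem this]

theorem artinRep_evalWordNat (n : ℕ) {w : List (ℕ × Bool)} (hw : ∀ p ∈ w, p.1 < n - 1) :
    artinRep n (evalWordNat n w) = (w.map artinLetterAut).prod := by
  induction w with
  | nil => exact map_one _
  | cons p w ih =>
    rw [List.forall_mem_cons] at hw
    rw [evalWordNat_cons n p w hw.1, map_mul, ih hw.2, List.map_cons, List.prod_cons,
      artinLetterAut, apply_ite (artinRep n), map_inv, artinRep_braidGenNat hw.1]

end BraidGroup

/-- There is a single computable function `F : ℕ × List (ℕ × Bool) → Bool`,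
uniform in the braid index, such that for every `n ≥ 2` and every word `w`
whose letters `(i, ε)` satisfy `i < n - 1`, `F (n, w) = true` if and only if
the corresponding word `σ_{i+1}^{±1}` in the Artin generators evaluates to the
identity of the braid group `B n`. -/
theorem braid_word_problem_uniformly_decidable :
    ∃ F : ℕ × List (ℕ × Bool) → Bool,
      Computable F ∧
        ∀ (n : ℕ) (w : List (ℕ × Bool)), 2 ≤ n → (∀ p ∈ w, p.1 < n - 1) →
          (F (n, w) = true ↔ evalWordNat n w = 1) := by
  refine ⟨braidWordTest, primrec_braidWordTest.to_comp, fun n w hn hw => ?_⟩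
  rw [braidWordTest_eq_true_iff, ← artinRep_evalWordNat n hw]
  have hρ : ∀ i < n - 1, artinRep n (braidGenNat n i) = artinAut i :=
    fun i hi => artinRep_braidGenNat hi
  refine ⟨fun h => ?_, fun h => by simp [h]⟩
  refine (satisfiesArtin_braidGenNat n).eq_one_of_apply_eq_one hρ le_rfl (evalWordNat_mem n hw)
    (mulAut_freeGroup_ext fun k => ?_)
  rcases Nat.lt_or_ge k n with hk | hk
  · exact h k hk
  · exact apply_of_of_lt hρ le_rfl (by omega) (evalWordNat_mem n hw)
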